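/- Let q, p ∈ ℕ ∪ {∞} and let Y = {(z_μ, w_μ) : μ = 1,…,L} be an antipodal free set in Ω_{2q} × Ω_{2p}. Then there exists T such that the L × L matrix [R_{m,n}^{q−2}(z_μ·z_ν) R_{k,l}^{p−2}(w_μ·w_ν)]_{μ,ν} is positive definite whenever m ≠ n, k ≠ l, m + n ≥ T and k + l ≥ T. -/

import Mathlib

open scoped ComplexOrder

noncomputable section

/-- The Hilbert space ℓ²(ℂ) of square–summable complex sequences. -/
abbrev Ell2 : Type := lp (fun _ : ℕ => ℂ) 2

/-- The Hermitian inner product of the paper: `hdot z w = z·w = Σ_j z_j conj(w_j)`. -/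
def hdot (z w : Ell2) : ℂ := @inner ℂ _ _ w z

/-- The sphere `Ω_{2q}` (for `q : ℕ∞`), viewed inside ℓ²(ℂ): the unit vectors supported
on the first `q` coordinates; for `q = ⊤` this is the unit sphere `Ω_∞` of ℓ²(ℂ). -/
def Omega (q : ℕ∞) : Set Ell2 :=
  {z | ‖z‖ = 1 ∧ ∀ j : ℕ, q ≤ (j : ℕ∞) → z j = 0}

/-- A kernel `K` is positive definite on a set `S`. -/
def IsPDKernel {α : Type*} (S : Set α) (K : α → α → ℂ) : Prop :=
  ∀ (L : ℕ) (x : Fin L → α), (∀ i, x i ∈ S) → Function.Injective x →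
    ∀ c : Fin L → ℂ, 0 ≤ ∑ μ, ∑ ν, c μ * (starRingEnd ℂ) (c ν) * K (x μ) (x ν)

/-- A kernel `K` is strictly positive definite on a set `S`. -/
def IsSPDKernel {α : Type*} (S : Set α) (K : α → α → ℂ) : Prop :=
  IsPDKernel S K ∧
    ∀ (L : ℕ) (x : Fin L → α), (∀ i, x i ∈ S) → Function.Injective x →
      ∀ c : Fin L → ℂ,
        ∑ μ, ∑ ν, c μ * (starRingEnd ℂ) (c ν) * K (x μ) (x ν) = 0 → c = 0

/-- `f` is positive definite on `Ω_{2q} × Ω_{2p}`. -/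
def PDonProd (q p : ℕ∞) (f : ℂ → ℂ → ℂ) : Prop :=
  IsPDKernel ((Omega q) ×ˢ (Omega p))
    (fun x y => f (hdot x.1 y.1) (hdot x.2 y.2))

/-- `f` is strictly positive definite on `Ω_{2q} × Ω_{2p}`. -/
def SPDonProd (q p : ℕ∞) (f : ℂ → ℂ → ℂ) : Prop :=
  IsSPDKernel ((Omega q) ×ˢ (Omega p))
    (fun x y => f (hdot x.1 y.1) (hdot x.2 y.2))

/-- `g` is positive definite on `Ω_{2q}`. -/
def PDonSphere (q : ℕ∞) (g : ℂ → ℂ) : Prop :=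
  IsPDKernel (Omega q) (fun z z' => g (hdot z z'))

/-- The Jacobi polynomial of degree `k` with (integer) parameters `α, β`, normalized
so that its value at `1` is `1`. -/
def jacobiR (α β k : ℕ) (x : ℝ) : ℝ :=
  (∑ s ∈ Finset.range (k + 1),
      ((k + α).choose (k - s) : ℝ) * ((k + β).choose s : ℝ) *
        ((x - 1) / 2) ^ s * ((x + 1) / 2) ^ (k - s)) /
    ((k + α).choose k : ℝ)

/-- The disc polynomial `R_{m,n}^{q-2}`; for `q = ⊤` (and also `q = 1`) it is
`ξ^m conj(ξ)^n`.  For `2 ≤ q < ⊤` it equals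
`r^{|m-n|} e^{i(m-n)φ} R_{min(m,n)}^{(q-2,|m-n|)}(2r²-1)` for `ξ = r e^{iφ}`. -/
def discR (q : ℕ∞) (m n : ℕ) (ξ : ℂ) : ℂ :=
  if q = ⊤ ∨ q ≤ 1 then ξ ^ m * (starRingEnd ℂ ξ) ^ n
  else (if n ≤ m then ξ ^ (m - n) else (starRingEnd ℂ ξ) ^ (n - m)) *
    ((jacobiR (q.toNat - 2) (max m n - min m n) (min m n)
        (2 * ‖ξ‖ ^ 2 - 1) : ℝ) : ℂ)

/-- The natural domain `𝔻̃`: the unit circle `∂𝔻` when `q = 1` (the sphere `Ω₂`),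
the closed unit disc `𝔻` otherwise. -/
def domD (q : ℕ∞) : Set ℂ :=
  if q = 1 then Metric.sphere (0 : ℂ) 1 else Metric.closedBall (0 : ℂ) 1

/-- `A ⊆ ℤ²` intersects every product of full arithmetic progressions in ℤ. -/
def MeetsAllProgressions (A : Set (ℤ × ℤ)) : Prop :=
  ∀ N M x y : ℤ, 0 < N → 0 < M → 0 < x → 0 < y →
    ∃ v ∈ A, (∃ j : ℤ, v.1 = N * j + x) ∧ (∃ j : ℤ, v.2 = M * j + y)

/-- A Hermitian matrix with unit diagonal and small off-diagonal entries is positive definite. -/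
theorem Matrix.posDef_of_norm_offDiag_lt {L : ℕ} {A : Matrix (Fin L) (Fin L) ℂ}
    (hA : A.IsHermitian) (hdiag : ∀ i, A i i = 1)
    (hoff : ∀ i j, i ≠ j → ‖A i j‖ < 1 / L) : A.PosDef := by
  rw [hA.posDef_iff_eigenvalues_pos]
  intro i
  have hev : Module.End.HasEigenvalue (Matrix.toLin' A) ((hA.eigenvalues i : ℝ) : ℂ) := by
    refine Module.End.hasEigenvalue_of_hasEigenvector (x := ⇑(hA.eigenvectorBasis i)) ⟨?_, ?_⟩
    · rw [Module.End.mem_eigenspace_iff, Matrix.toLin'_apply, hA.mulVec_eigenvectorBasis]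
      simp
    · intro h
      apply hA.eigenvectorBasis.orthonormal.ne_zero i
      ext j
      exact congrFun h j
  obtain ⟨k, hk⟩ := eigenvalue_mem_ball hev
  rw [Metric.mem_closedBall, hdiag, Complex.dist_eq] at hk
  have hL : (0 : ℝ) < L := by exact_mod_cast i.pos
  have hsum : ∑ j ∈ Finset.univ.erase k, ‖A k j‖ < 1 := by
    calc ∑ j ∈ Finset.univ.erase k, ‖A k j‖
        ≤ ∑ j ∈ Finset.univ.erase k, (1 / L : ℝ) :=
          Finset.sum_le_sum fun j hj => (hoff k j (Finset.ne_of_mem_erase hj).symm).le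
      _ = ((L - 1 : ℕ) : ℝ) * (1 / L) := by simp
      _ < L * (1 / L) := by
          gcongr
          exact Nat.sub_lt i.pos one_pos
      _ = 1 := by field_simp
  have := (Complex.abs_re_le_norm _).trans hk
  simp only [Complex.sub_re, Complex.ofReal_re, Complex.one_re] at this
  linarith [(abs_le.mp this).1]

/-- The Fourier coefficients of a polynomial on a circle about the origin. -/
theorem Polynomial.integral_eval_circle (P : Polynomial ℂ) (R : ℝ) (k : ℕ) :
    ∫ θ in (0 : ℝ)..2 * Real.pi,
      P.eval (R * Complex.exp (θ * Complex.I)) * Complex.exp (-(k * θ * Complex.I)) =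
      2 * Real.pi * (P.coeff k * R ^ k) := by
  have hexp : ∀ j : ℕ, ∫ θ in (0 : ℝ)..2 * Real.pi,
      Complex.exp ((((j : ℂ) - k) * Complex.I) * θ) = if j = k then 2 * Real.pi else 0 := by
    intro j
    split_ifs with h
    · simp [h]
    · have hjk : ((j : ℂ) - k) ≠ 0 := sub_ne_zero.mpr (by exact_mod_cast h)
      rw [integral_exp_mul_complex (mul_ne_zero hjk Complex.I_ne_zero)]
      have : Complex.exp (((j : ℂ) - k) * Complex.I * ((2 * Real.pi : ℝ) : ℂ)) = 1 := by
        rw [Complex.exp_eq_one_iff]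
        refine ⟨(j : ℤ) - k, ?_⟩
        push_cast
        ring
      rw [this]
      simp
  have hterm : ∀ θ : ℝ,
      P.eval (R * Complex.exp (θ * Complex.I)) * Complex.exp (-(k * θ * Complex.I)) =
      ∑ j ∈ P.support, P.coeff j * (R : ℂ) ^ j *
        Complex.exp ((((j : ℂ) - k) * Complex.I) * θ) := by
    intro θ
    rw [Polynomial.eval_eq_sum, Polynomial.sum, Finset.sum_mul]
    refine Finset.sum_congr rfl fun j _ => ?_
    rw [mul_pow, ← Complex.exp_nat_mul, mul_assoc, mul_assoc, ← Complex.exp_add, mul_assoc]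
    ring_nf
  simp_rw [hterm]
  rw [intervalIntegral.integral_finsetSum
    fun j _ => (Continuous.intervalIntegrable (by fun_prop) _ _)]
  simp_rw [intervalIntegral.integral_const_mul, hexp]
  by_cases hk : k ∈ P.support
  · rw [Finset.sum_eq_single_of_mem k hk fun j _ hj => by simp [hj]]
    simp
    ring
  · rw [Polynomial.notMem_support_iff.mp hk]
    rw [Finset.sum_eq_zero]
    · simp
    · intro j hj
      have : j ≠ k := fun h => hk (h ▸ hj)
      simp [this]

/-- The unnormalized Jacobi sum as a coefficient of a product of two powers. -/
theorem coeff_one_add_pow_mul_one_add_pow (a b : ℂ) (M N k : ℕ) :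
    ((1 + Polynomial.C b * Polynomial.X) ^ M * (1 + Polynomial.C a * Polynomial.X) ^ N).coeff k =
      ∑ s ∈ Finset.range (k + 1), (M.choose (k - s) : ℂ) * (N.choose s : ℂ) * a ^ s *
        b ^ (k - s) := by
  have hpow : ∀ (c : ℂ) (n j : ℕ),
      ((1 + Polynomial.C c * Polynomial.X) ^ n).coeff j = (n.choose j : ℂ) * c ^ j := by
    intro c n j
    have : (1 + Polynomial.C c * Polynomial.X) ^ n =
        ((1 + Polynomial.X) ^ n : Polynomial ℂ).comp (Polynomial.C c * Polynomial.X) := by simp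
    rw [this, Polynomial.comp_C_mul_X_coeff, Polynomial.coeff_one_add_X_pow]
  rw [mul_comm, Polynomial.coeff_mul, Finset.Nat.sum_antidiagonal_eq_sum_range_succ_mk]
  refine Finset.sum_congr rfl fun s _ => ?_
  rw [hpow, hpow]
  ring

/-- With `τ = ρ e^{iθ}` and `r² + s² = 1`, one has `|s + r τ|² = ρ² + circleDefect r s ρ θ` and
`|r - s τ|² = 1 - circleDefect r s ρ θ`. -/
def circleDefect (r s ρ θ : ℝ) : ℝ := s ^ 2 * (1 - ρ ^ 2) + 2 * r * s * ρ * Real.cos θ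

/-- A majorant of the normalized modulus of the contour integrand on the circle of radius `ρ`. -/
def circleBound (r s ρ θ : ℝ) : ℝ :=
  Real.exp (circleDefect r s ρ θ / 2) * √(1 - circleDefect r s ρ θ)

theorem circleBound_nonneg (r s ρ θ : ℝ) : 0 ≤ circleBound r s ρ θ := by
  unfold circleBound
  positivity

theorem exp_half_mul_sqrt_exp_neg (h : ℝ) : Real.exp (h / 2) * √(Real.exp (-h)) = 1 := by
  rw [← Real.exp_half, ← Real.exp_add]
  simp [neg_div]

theorem circleBound_le_one (r s ρ θ : ℝ) : circleBound r s ρ θ ≤ 1 := by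
  rw [← exp_half_mul_sqrt_exp_neg (circleDefect r s ρ θ)]
  unfold circleBound
  gcongr
  exact Real.one_sub_le_exp_neg _

theorem circleBound_lt_one {r s ρ θ : ℝ} (h : circleDefect r s ρ θ ≠ 0) :
    circleBound r s ρ θ < 1 := by
  rw [← exp_half_mul_sqrt_exp_neg (circleDefect r s ρ θ)]
  unfold circleBound
  refine mul_lt_mul_of_pos_left ?_ (Real.exp_pos _)
  rw [Real.sqrt_lt_sqrt_iff_of_pos (Real.exp_pos _)]
  linarith [Real.add_one_lt_exp (neg_ne_zero.mpr h)]

theorem ae_circleDefect_ne_zero {r s : ℝ} (hr : 0 < r) (hs : 0 < s) (ρ : ℝ) :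
    ∀ᵐ θ : ℝ, circleDefect r s ρ θ ≠ 0 := by
  have hcount : {θ : ℝ | circleDefect r s ρ θ = 0}.Countable := by
    rcases eq_or_ne ρ 0 with rfl | hρ
    · convert Set.countable_empty
      ext θ
      simp [circleDefect, hs.ne']
    · rcases Set.eq_empty_or_nonempty {θ : ℝ | circleDefect r s ρ θ = 0} with h | ⟨θ₀, h₀⟩
      · simp [h]
      · refine ((Set.countable_range fun k : ℤ => 2 * k * Real.pi + θ₀).union
          (Set.countable_range fun k : ℤ => 2 * k * Real.pi - θ₀)).mono fun θ hθ => ?_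
        have hcos : Real.cos θ₀ = Real.cos θ := by
          simp only [Set.mem_ofPred_eq, circleDefect] at h₀ hθ
          have : 2 * r * s * ρ ≠ 0 := by positivity
          apply mul_left_cancel₀ this
          linarith
        obtain ⟨k, hk | hk⟩ := Real.cos_eq_cos_iff.mp hcos
        · exact Or.inl ⟨k, hk.symm⟩
        · exact Or.inr ⟨k, hk.symm⟩
  simpa [MeasureTheory.ae_iff] using hcount.measure_zero MeasureTheory.volume

/-- The integrals of the powers of `circleBound` tend to zero uniformly in the radius. -/
theorem integral_circleBound_pow_lt {r s : ℝ} (hr : 0 < r) (hs : 0 < s) {ε : ℝ} (hε : 0 < ε) :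
    ∃ N₀ : ℕ, ∀ N ≥ N₀, ∀ ρ ∈ Set.Icc (0 : ℝ) 1,
      ∫ θ in (0 : ℝ)..2 * Real.pi, circleBound r s ρ θ ^ N < ε := by
  by_contra! hcon
  choose N hN ρ hρ hJ_le using hcon
  obtain ⟨ρ₀, -, φ, hφ, hlim⟩ := isCompact_Icc.tendsto_subseq hρ
  have hNφ : Filter.Tendsto (fun i => N (φ i)) Filter.atTop Filter.atTop :=
    Filter.tendsto_atTop_mono (fun i => (hφ.id_le i).trans (hN (φ i))) Filter.tendsto_id
  have key : Filter.Tendsto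
      (fun i => ∫ θ in (0 : ℝ)..2 * Real.pi, circleBound r s (ρ (φ i)) θ ^ N (φ i))
      Filter.atTop (nhds (∫ _ in (0 : ℝ)..2 * Real.pi, (0 : ℝ))) := by
    refine intervalIntegral.tendsto_integral_filter_of_dominated_convergence (fun _ => 1)
      (Filter.Eventually.of_forall fun i => ?_) (Filter.Eventually.of_forall fun i => ?_)
      intervalIntegrable_const ?_
    · apply Continuous.aestronglyMeasurable
      unfold circleBound circleDefect
      fun_prop
    · refine Filter.Eventually.of_forall fun θ _ => ?_
      rw [Real.norm_of_nonneg (pow_nonneg (circleBound_nonneg _ _ _ _) _)]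
      exact pow_le_one₀ (circleBound_nonneg _ _ _ _) (circleBound_le_one _ _ _ _)
    · filter_upwards [ae_circleDefect_ne_zero hr hs ρ₀] with θ hθ _
      have hcont : Continuous fun t => circleBound r s t θ := by
        unfold circleBound circleDefect
        fun_prop
      have hb := (hcont.tendsto ρ₀).comp hlim
      obtain ⟨c, hc₁, hc₂⟩ := exists_between (circleBound_lt_one hθ)
      have hc₀ : 0 ≤ c := (circleBound_nonneg _ _ _ _).trans hc₁.le
      refine squeeze_zero' (Filter.Eventually.of_forall fun i =>
        pow_nonneg (circleBound_nonneg _ _ _ _) _) ?_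
        ((tendsto_pow_atTop_nhds_zero_of_lt_one hc₀ hc₂).comp hNφ)
      filter_upwards [hb.eventually (gt_mem_nhds hc₁)] with i hi
      exact pow_le_pow_left₀ (circleBound_nonneg _ _ _ _) hi.le _
  rw [intervalIntegral.integral_zero] at key
  obtain ⟨i, hi⟩ := (key.eventually (gt_mem_nhds hε)).exists
  exact absurd hi (not_lt.mpr (hJ_le _))

theorem norm_one_add_mul_exp {r s : ℝ} (hr : 0 < r) (hs : 0 < s) (hrs : r ^ 2 + s ^ 2 = 1)
    (ρ θ : ℝ) :
    ‖(1 : ℂ) + (r ^ 2 : ℝ) * ((ρ / (r * s) : ℝ) * Complex.exp (θ * Complex.I))‖ =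
      √(ρ ^ 2 + circleDefect r s ρ θ) / s := by
  rw [← Real.sqrt_sq (norm_nonneg _), ← Real.sqrt_sq hs.le, ← Real.sqrt_div' _ (by positivity),
    Real.sqrt_sq hs.le, Complex.sq_norm, Complex.normSq_apply]
  congr 1
  simp only [Complex.add_re, Complex.one_re, Complex.re_ofReal_mul, Complex.exp_ofReal_mul_I_re,
    Complex.add_im, Complex.one_im, Complex.im_ofReal_mul, Complex.exp_ofReal_mul_I_im,
    circleDefect]
  have hsin := Real.sin_sq_add_cos_sq θ
  have hr₀ := hr.ne'
  have hs₀ := hs.ne'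
  field_simp
  linear_combination (ρ ^ 2 * r ^ 2) * hsin + ρ ^ 2 * hrs

theorem norm_one_sub_mul_exp {r s : ℝ} (hr : 0 < r) (hs : 0 < s) (hrs : r ^ 2 + s ^ 2 = 1)
    (ρ θ : ℝ) :
    ‖(1 : ℂ) + (-s ^ 2 : ℝ) * ((ρ / (r * s) : ℝ) * Complex.exp (θ * Complex.I))‖ =
      √(1 - circleDefect r s ρ θ) / r := by
  rw [← Real.sqrt_sq (norm_nonneg _), ← Real.sqrt_sq hr.le, ← Real.sqrt_div' _ (by positivity),
    Real.sqrt_sq hr.le, Complex.sq_norm, Complex.normSq_apply]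
  congr 1
  simp only [Complex.add_re, Complex.one_re, Complex.re_ofReal_mul, Complex.exp_ofReal_mul_I_re,
    Complex.add_im, Complex.one_im, Complex.im_ofReal_mul, Complex.exp_ofReal_mul_I_im,
    circleDefect]
  have hsin := Real.sin_sq_add_cos_sq θ
  have hr₀ := hr.ne'
  have hs₀ := hs.ne'
  field_simp
  linear_combination (ρ ^ 2 * s ^ 2) * hsin + hrs

/-- The optimal radius `ρ² = k / (k + β)` turns the contour integrand into a power of
`circleBound`. -/
theorem sqrt_pow_mul_sqrt_pow_le (r s θ : ℝ) (k β : ℕ) {ρ : ℝ} (hρ₀ : 0 ≤ ρ)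
    (hρ : ρ ^ 2 * (k + β) = k) (hdefect : k = 0 → 0 ≤ circleDefect r s ρ θ) :
    √(ρ ^ 2 + circleDefect r s ρ θ) ^ k * √(1 - circleDefect r s ρ θ) ^ (k + β) ≤
      ρ ^ k * circleBound r s ρ θ ^ (k + β) := by
  rw [circleBound, mul_pow, ← mul_assoc]
  gcongr
  generalize circleDefect r s ρ θ = h at *
  rcases Nat.eq_zero_or_pos k with rfl | hk
  · simpa using one_le_pow₀ (Real.one_le_exp (by linarith [hdefect rfl]))
  have hk' : (0 : ℝ) < k := by exact_mod_cast hk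
  have hρpos : 0 < ρ := by
    refine lt_of_le_of_ne hρ₀ fun h => ?_
    rw [← h] at hρ
    simp at hρ
    linarith
  have h₁ : √(ρ ^ 2 + h) ≤ ρ * Real.exp (h / (2 * ρ ^ 2)) := by
    rw [Real.sqrt_le_left (by positivity), mul_pow, ← Real.exp_nat_mul]
    have := Real.add_one_le_exp (h / ρ ^ 2)
    calc ρ ^ 2 + h = ρ ^ 2 * (h / ρ ^ 2 + 1) := by field_simp; ring
      _ ≤ ρ ^ 2 * Real.exp (h / ρ ^ 2) := by gcongr
      _ = _ := by
        congr 2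
        push_cast
        field_simp
  calc √(ρ ^ 2 + h) ^ k ≤ (ρ * Real.exp (h / (2 * ρ ^ 2))) ^ k := by gcongr
    _ = ρ ^ k * Real.exp (h / 2) ^ (k + β) := by
      rw [mul_pow, ← Real.exp_nat_mul, ← Real.exp_nat_mul]
      congr 2
      push_cast
      field_simp
      linear_combination -h * hρ

theorem jacobiR_eq_coeff (α β k : ℕ) {r s : ℝ} (hrs : r ^ 2 + s ^ 2 = 1) :
    ((jacobiR α β k (2 * r ^ 2 - 1) : ℝ) : ℂ) =
      ((1 + Polynomial.C ((r ^ 2 : ℝ) : ℂ) * Polynomial.X) ^ (k + α) *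
        (1 + Polynomial.C ((-s ^ 2 : ℝ) : ℂ) * Polynomial.X) ^ (k + β)).coeff k /
        ((k + α).choose k : ℂ) := by
  have h₁ : (2 * r ^ 2 - 1 - 1) / 2 = -s ^ 2 := by linarith
  have h₂ : (2 * r ^ 2 - 1 + 1) / 2 = r ^ 2 := by ring
  rw [coeff_one_add_pow_mul_one_add_pow, jacobiR, h₁, h₂]
  push_cast
  rfl

/-- Contour integral bound for Jacobi polynomials, on the circle of optimal radius. -/
theorem pow_mul_abs_jacobiR_le {r s : ℝ} (hr : 0 < r) (hs : 0 < s) (hrs : r ^ 2 + s ^ 2 = 1)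
    (α β k : ℕ) {ρ : ℝ} (hρmem : ρ ∈ Set.Icc (0 : ℝ) 1) (hρ : ρ ^ 2 * (k + β) = k)
    (hk₀ : k = 0 → ρ = 0) :
    r ^ β * |jacobiR α β k (2 * r ^ 2 - 1)| ≤
      (1 + r / s) ^ α * ∫ θ in (0 : ℝ)..2 * Real.pi, circleBound r s ρ θ ^ (k + β) := by
  obtain ⟨hρ₀, hρ₁⟩ := hρmem
  set P : Polynomial ℂ := (1 + Polynomial.C ((r ^ 2 : ℝ) : ℂ) * Polynomial.X) ^ (k + α) *
    (1 + Polynomial.C ((-s ^ 2 : ℝ) : ℂ) * Polynomial.X) ^ (k + β) with hP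
  set R : ℝ := ρ / (r * s) with hR
  have hR₀ : 0 ≤ R := by positivity
  have hRk : 0 < R ^ k := by
    rcases Nat.eq_zero_or_pos k with rfl | hk
    · simp
    · have hk' : (0 : ℝ) < k := by exact_mod_cast hk
      have : ρ ≠ 0 := by
        rintro rfl
        simp at hρ
        linarith
      positivity
  have hbound : ∀ θ : ℝ,
      ‖P.eval (R * Complex.exp (θ * Complex.I)) * Complex.exp (-(k * θ * Complex.I))‖ ≤
        (1 + r / s) ^ α * R ^ k / r ^ β * circleBound r s ρ θ ^ (k + β) := by
    intro θ
    have hexp : ‖Complex.exp (-(k * θ * Complex.I))‖ = 1 := by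
      have : -((k : ℂ) * θ * Complex.I) = ((-(k * θ) : ℝ) : ℂ) * Complex.I := by
        push_cast
        ring
      rw [this, Complex.norm_exp_ofReal_mul_I]
    have hle : ‖(1 : ℂ) + (r ^ 2 : ℝ) * (R * Complex.exp (θ * Complex.I))‖ ≤ 1 + r / s := by
      refine (norm_add_le _ _).trans ?_
      rw [norm_one, norm_mul, norm_mul, Complex.norm_exp_ofReal_mul_I, Complex.norm_real,
        Complex.norm_real, Real.norm_of_nonneg (sq_nonneg r), Real.norm_of_nonneg hR₀, mul_one, hR]
      have : r ^ 2 * (ρ / (r * s)) = r / s * ρ := by field_simp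
      rw [this]
      gcongr
      exact mul_le_of_le_one_right (by positivity) hρ₁
    have hdefect : k = 0 → 0 ≤ circleDefect r s ρ θ := by
      intro h
      simp [circleDefect, hk₀ h]
      positivity
    rw [norm_mul, hexp, mul_one, hP]
    simp only [Polynomial.eval_mul, Polynomial.eval_pow, Polynomial.eval_add, Polynomial.eval_one,
      Polynomial.eval_C, Polynomial.eval_X, norm_mul, norm_pow]
    rw [pow_add _ k α, norm_one_sub_mul_exp hr hs hrs]
    calc _ ≤ (√(ρ ^ 2 + circleDefect r s ρ θ) / s) ^ k * (1 + r / s) ^ α *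
          (√(1 - circleDefect r s ρ θ) / r) ^ (k + β) := by
          rw [norm_one_add_mul_exp hr hs hrs] at hle ⊢
          gcongr
      _ = (1 + r / s) ^ α / (s ^ k * r ^ (k + β)) * (√(ρ ^ 2 + circleDefect r s ρ θ) ^ k *
          √(1 - circleDefect r s ρ θ) ^ (k + β)) := by
          rw [div_pow, div_pow]
          field_simp
      _ ≤ (1 + r / s) ^ α / (s ^ k * r ^ (k + β)) * (ρ ^ k * circleBound r s ρ θ ^ (k + β)) := by
          exact mul_le_mul_of_nonneg_left
            (sqrt_pow_mul_sqrt_pow_le r s θ k β hρ₀ hρ hdefect) (by positivity)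
      _ = _ := by
          rw [hR, div_pow, mul_pow, pow_add r]
          field_simp
  have hJ_le := intervalIntegral.norm_integral_le_of_norm_le
    (μ := MeasureTheory.volume) (a := 0) (b := 2 * Real.pi)
    Real.two_pi_pos.le (Filter.Eventually.of_forall fun θ _ => hbound θ)
    (Continuous.intervalIntegrable (by unfold circleBound circleDefect; fun_prop) _ _)
  rw [Polynomial.integral_eval_circle, intervalIntegral.integral_const_mul] at hJ_le
  simp only [norm_mul, norm_pow, Complex.norm_real, Complex.norm_two,
    Real.norm_of_nonneg Real.pi_pos.le, Real.norm_of_nonneg hR₀] at hJ_le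
  have hjac : |jacobiR α β k (2 * r ^ 2 - 1)| ≤ ‖P.coeff k‖ := by
    rw [← Real.norm_eq_abs, ← Complex.norm_real, jacobiR_eq_coeff α β k hrs, norm_div,
      Complex.norm_natCast]
    refine div_le_self (norm_nonneg _) ?_
    exact_mod_cast Nat.choose_pos (Nat.le_add_right k α)
  set J := ∫ θ in (0 : ℝ)..2 * Real.pi, circleBound r s ρ θ ^ (k + β)
  have hπ : 1 ≤ 2 * Real.pi := by linarith [Real.pi_gt_three]
  have hc : ‖P.coeff k‖ * R ^ k ≤ (1 + r / s) ^ α * R ^ k / r ^ β * J :=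
    (le_mul_of_one_le_left (by positivity) hπ).trans hJ_le
  have hc' : ‖P.coeff k‖ ≤ (1 + r / s) ^ α * J / r ^ β := by
    refine le_of_mul_le_mul_right (hc.trans_eq ?_) hRk
    ring
  rw [le_div_iff₀ (by positivity)] at hc'
  calc r ^ β * |jacobiR α β k (2 * r ^ 2 - 1)| ≤ r ^ β * ‖P.coeff k‖ := by gcongr
    _ ≤ _ := by rwa [mul_comm]

theorem pow_mul_abs_jacobiR_lt {r : ℝ} (hr : 0 < r) (hr₁ : r < 1) (α : ℕ) {ε : ℝ} (hε : 0 < ε) :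
    ∃ N₀ : ℕ, ∀ k β : ℕ, N₀ ≤ k + β → r ^ β * |jacobiR α β k (2 * r ^ 2 - 1)| < ε := by
  have hpos : 0 < 1 - r ^ 2 := by nlinarith
  set s := √(1 - r ^ 2)
  have hs : 0 < s := Real.sqrt_pos.mpr hpos
  have hrs : r ^ 2 + s ^ 2 = 1 := by
    rw [Real.sq_sqrt hpos.le]
    ring
  have hK : 0 < (1 + r / s) ^ α := by positivity
  obtain ⟨N₀, hN₀⟩ := integral_circleBound_pow_lt hr hs (div_pos hε hK)
  refine ⟨N₀, fun k β hkβ => ?_⟩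
  have hmem : √((k : ℝ) / (k + β)) ∈ Set.Icc (0 : ℝ) 1 :=
    ⟨Real.sqrt_nonneg _, Real.sqrt_le_one.mpr (div_le_one_of_le₀ (by simp) (by positivity))⟩
  have hsq : √((k : ℝ) / (k + β)) ^ 2 * (k + β) = k := by
    rw [Real.sq_sqrt (by positivity)]
    refine div_mul_cancel_of_imp fun h => ?_
    have : (0 : ℝ) ≤ β := by positivity
    have : (0 : ℝ) ≤ k := by positivity
    linarith
  refine (pow_mul_abs_jacobiR_le hr hs hrs α β k hmem hsq ?_).trans_lt ?_
  · rintro rfl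
    simp
  · have := hN₀ (k + β) hkβ _ hmem
    rwa [lt_div_iff₀' hK] at this

/-- Disc polynomials with `m ≠ n` tend to zero in the open unit disc as `m + n → ∞`. -/
theorem norm_discR_lt (q : ℕ∞) {ξ : ℂ} (hξ : ‖ξ‖ < 1) {ε : ℝ} (hε : 0 < ε) :
    ∃ T : ℕ, ∀ m n : ℕ, m ≠ n → T ≤ m + n → ‖discR q m n ξ‖ < ε := by
  by_cases hq : q = ⊤ ∨ q ≤ 1
  · obtain ⟨T, hT⟩ := Filter.eventually_atTop.mp
      ((tendsto_pow_atTop_nhds_zero_of_lt_one (norm_nonneg ξ) hξ).eventually (gt_mem_nhds hε))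
    refine ⟨T, fun m n _ h => ?_⟩
    simpa [discR, hq, ← pow_add] using hT _ h
  have hnorm : ∀ m n : ℕ, ‖discR q m n ξ‖ = ‖ξ‖ ^ (max m n - min m n) *
      |jacobiR (q.toNat - 2) (max m n - min m n) (min m n) (2 * ‖ξ‖ ^ 2 - 1)| := by
    intro m n
    rw [discR, if_neg hq, norm_mul, Complex.norm_real, Real.norm_eq_abs]
    congr 1
    split_ifs with h
    · simp [h]
    · simp [(not_le.mp h).le]
  rcases (norm_nonneg ξ).eq_or_lt with h₀ | h₀
  · refine ⟨0, fun m n hmn _ => ?_⟩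
    rw [hnorm, ← h₀, zero_pow (by omega), zero_mul]
    exact hε
  · obtain ⟨N₀, hN₀⟩ := pow_mul_abs_jacobiR_lt h₀ hξ (q.toNat - 2) hε
    refine ⟨2 * N₀, fun m n _ h => ?_⟩
    rw [hnorm]
    exact hN₀ _ _ (by omega)

theorem discR_one (q : ℕ∞) (m n : ℕ) : discR q m n 1 = 1 := by
  by_cases hq : q = ⊤ ∨ q ≤ 1
  · simp [discR, hq]
  · have hjac : ∀ α β k : ℕ, jacobiR α β k 1 = 1 := by
      intro α β k
      have : ((k + α).choose k : ℝ) ≠ 0 := by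
        exact_mod_cast (Nat.choose_pos (Nat.le_add_right k α)).ne'
      rw [jacobiR, Finset.sum_range_succ', Finset.sum_eq_zero]
      · norm_num [this]
      · intro s _
        simp
    rw [discR, if_neg hq]
    norm_num [hjac]

theorem star_discR (q : ℕ∞) (m n : ℕ) (ξ : ℂ) : star (discR q m n ξ) = discR q m n (star ξ) := by
  unfold discR
  split_ifs <;> simp

theorem hdot_self_of_mem_Omega {q : ℕ∞} {z : Ell2} (hz : z ∈ Omega q) : hdot z z = 1 := by
  rw [hdot, inner_self_eq_norm_sq_to_K, hz.1]
  simp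

theorem star_hdot (z w : Ell2) : star (hdot z w) = hdot w z :=
  inner_conj_symm _ _

/-- Uniform version of `norm_discR_lt` over the finitely many pairs of distinct points. -/
theorem exists_norm_discR_hdot_lt (q : ℕ∞) {L : ℕ} (z : Fin L → Ell2) {ε : ℝ} (hε : 0 < ε) :
    ∃ T : ℕ, ∀ μ ν, ‖hdot (z μ) (z ν)‖ < 1 → ∀ m n : ℕ, m ≠ n → T ≤ m + n →
      ‖discR q m n (hdot (z μ) (z ν))‖ < ε := by
  have h : ∀ μ ν, ∃ T : ℕ, ‖hdot (z μ) (z ν)‖ < 1 → ∀ m n : ℕ, m ≠ n → T ≤ m + n →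
      ‖discR q m n (hdot (z μ) (z ν))‖ < ε := by
    intro μ ν
    by_cases hlt : ‖hdot (z μ) (z ν)‖ < 1
    · obtain ⟨T, hT⟩ := norm_discR_lt q hlt hε
      exact ⟨T, fun _ => hT⟩
    · exact ⟨0, fun h => absurd h hlt⟩
  choose T hT using h
  refine ⟨∑ μ, ∑ ν, T μ ν, fun μ ν hlt m n hmn hle => hT μ ν hlt m n hmn (le_trans ?_ hle)⟩
  exact (Finset.single_le_sum (f := T μ) (fun _ _ => Nat.zero_le _) (Finset.mem_univ ν)).trans
    (Finset.single_le_sum (f := fun μ => ∑ ν, T μ ν) (fun _ _ => Nat.zero_le _)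
      (Finset.mem_univ μ))

/-- Lemma 3.6 / `lm_PDlimit`: if `Y = {(z_μ, w_μ)}` is an antipodal
free set in `Ω_{2q} × Ω_{2p}`, there is a threshold `T` such that the matrix
`[R_{m,n}^{q-2}(z_μ·z_ν) R_{k,l}^{p-2}(w_μ·w_ν)]` is positive definite whenever
`m ≠ n`, `k ≠ l` and `m + n, k + l ≥ T`. -/
theorem stmt12 (q p : ℕ∞) (hq : 1 ≤ q) (hp : 1 ≤ p)
    (L : ℕ) (y : Fin L → Ell2 × Ell2)
    (hmem : ∀ μ, y μ ∈ (Omega q) ×ˢ (Omega p)) (hinj : Function.Injective y)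
    (hAF : ∀ μ ν, μ ≠ ν →
      ((y μ).1 = (y ν).1 ∨ ‖hdot (y μ).1 (y ν).1‖ < 1) ∧
      ((y μ).2 = (y ν).2 ∨ ‖hdot (y μ).2 (y ν).2‖ < 1)) :
    ∃ T : ℕ, ∀ m n k l : ℕ, m ≠ n → k ≠ l → T ≤ m + n → T ≤ k + l →
      (Matrix.of fun μ ν : Fin L =>
        discR q m n (hdot (y μ).1 (y ν).1) *
          discR p k l (hdot (y μ).2 (y ν).2)).PosDef := by
  rcases Nat.eq_zero_or_pos L with rfl | hL
  · exact ⟨0, fun _ _ _ _ _ _ _ _ =>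
      Matrix.posDef_of_norm_offDiag_lt (by ext i; exact i.elim0) (fun i => i.elim0)
        fun i => i.elim0⟩
  have hL₀ : (0 : ℝ) < L := by exact_mod_cast hL
  have hL₁ : 1 / (L : ℝ) ≤ 1 := by
    rw [div_le_one hL₀]
    exact_mod_cast hL
  have hε : 0 < 1 / (L : ℝ) := by positivity
  obtain ⟨T₁, hT₁⟩ := exists_norm_discR_hdot_lt q (fun μ => (y μ).1) hε
  obtain ⟨T₂, hT₂⟩ := exists_norm_discR_hdot_lt p (fun μ => (y μ).2) hε
  refine ⟨max T₁ T₂, fun m n k l hmn hkl hTmn hTkl => ?_⟩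
  have hself₁ : ∀ μ, discR q m n (hdot (y μ).1 (y μ).1) = 1 := fun μ => by
    rw [hdot_self_of_mem_Omega (hmem μ).1, discR_one]
  have hself₂ : ∀ μ, discR p k l (hdot (y μ).2 (y μ).2) = 1 := fun μ => by
    rw [hdot_self_of_mem_Omega (hmem μ).2, discR_one]
  refine Matrix.posDef_of_norm_offDiag_lt ?_ ?_ ?_
  · ext μ ν
    simp only [Matrix.conjTranspose_apply, Matrix.of_apply, star_mul', star_discR, star_hdot]
  · intro μ
    rw [Matrix.of_apply, hself₁, hself₂, mul_one]
  · intro μ ν hμν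
    have hsmall₁ := fun h => hT₁ μ ν h m n hmn ((le_max_left _ _).trans hTmn)
    have hsmall₂ := fun h => hT₂ μ ν h k l hkl ((le_max_right _ _).trans hTkl)
    rw [Matrix.of_apply, norm_mul]
    obtain ⟨h₁ | h₁, h₂ | h₂⟩ := hAF μ ν hμν
    · exact absurd (hinj (Prod.ext h₁ h₂)) hμν
    · rw [← h₁, hself₁, norm_one, one_mul]
      exact hsmall₂ h₂
    · rw [← h₂, hself₂, norm_one, mul_one]
      exact hsmall₁ h₁
    · calc _ ≤ ‖discR q m n (hdot (y μ).1 (y ν).1)‖ * 1 := by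
            gcongr
            exact (hsmall₂ h₂).le.trans hL₁
        _ < _ := by
            rw [mul_one]
            exact hsmall₁ h₁

end
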